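/- Let ρ ∈ [0,1], m̂ > 0 and χ̂ > 0. Let x⁰ be distributed according to the Bernoulli–Gaussian measure μ_ρ and let z be an independent standard Gaussian random variable. Then (1/√χ̂)·E[ z · x̂₀(√χ̂·z + m̂·x⁰; m̂) ] = (2(1−ρ)/m̂)·r₀(m̂/χ̂) + (2ρ/m̂)·r₀( m̂/(m̂² + χ̂) ). -/

import Mathlib

open MeasureTheory ProbabilityTheory

/-- Standard Gaussian tail function `𝒬(x) = ∫_x^∞ e^{−z²/2}/√(2π) dz`. -/
noncomputable def gaussQ (x : ℝ) : ℝ :=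
  ∫ z in Set.Ioi x, Real.exp (-z ^ 2 / 2) / Real.sqrt (2 * Real.pi)

/-- `r₀(h) = e^{−h}·√(h/π) + 𝒬(√(2h))`. -/
noncomputable def r0Fun (h : ℝ) : ℝ :=
  Real.exp (-h) * Real.sqrt (h / Real.pi) + gaussQ (Real.sqrt (2 * h))

/-- Hard-thresholding function: `x̂₀(y; m̂) = y/m̂` if `|y| > √(2m̂)` and `0` otherwise. -/
noncomputable def hardThresh (y mh : ℝ) : ℝ :=
  if Real.sqrt (2 * mh) < |y| then y / mh else 0

/-- Bernoulli–Gaussian measure `μ_ρ = (1−ρ)·δ₀ + ρ·N(0,1)` on `ℝ`. -/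
noncomputable def bgMeasure (ρ : ℝ) : Measure ℝ :=
  ENNReal.ofReal (1 - ρ) • Measure.dirac (0 : ℝ) + ENNReal.ofReal ρ • gaussianReal 0 1

lemma measurable_hardThresh (mh : ℝ) : Measurable (fun y ↦ hardThresh y mh) := by
  unfold hardThresh
  exact Measurable.ite (measurableSet_lt measurable_const (by fun_prop)) (by fun_prop)
    measurable_const

lemma norm_hardThresh_le (y mh : ℝ) : ‖hardThresh y mh‖ ≤ ‖y / mh‖ := by
  unfold hardThresh
  split_ifs
  · rfl
  · simp [div_nonneg]

lemma integrable_sq_gaussianReal : Integrable (fun x : ℝ ↦ x ^ 2) (gaussianReal 0 1) := by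
  simpa using (memLp_id_gaussianReal (μ := 0) (v := 1) 2).integrable_sq

lemma integrable_id_gaussianReal : Integrable (fun x : ℝ ↦ x) (gaussianReal 0 1) := by
  exact (memLp_id_gaussianReal (μ := 0) (v := 1) 1).integrable (by simp)

lemma gaussianPDFReal_zero_one (y : ℝ) :
    gaussianPDFReal 0 1 y = Real.exp (-y ^ 2 / 2) / √(2 * Real.pi) := by
  simp [gaussianPDFReal, div_eq_inv_mul]

lemma integrable_sq_mul_gaussianPDFReal :
    Integrable (fun y ↦ y ^ 2 * gaussianPDFReal 0 1 y) := by
  have h := integrable_rpow_mul_exp_neg_mul_sq (b := 1 / 2) (by norm_num) (s := 2) (by norm_num)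
  refine (h.div_const √(2 * Real.pi)).congr (ae_of_all _ fun y ↦ ?_)
  simp only [gaussianPDFReal_zero_one, Real.rpow_ofNat]
  ring_nf

lemma hasDerivAt_gaussianPDFReal_zero_one (y : ℝ) :
    HasDerivAt (gaussianPDFReal 0 1) (-y * gaussianPDFReal 0 1 y) y := by
  have h : HasDerivAt (fun y : ℝ ↦ -y ^ 2 / 2) (-y) y := by
    refine (((hasDerivAt_id y).pow 2).neg.div_const 2).congr_deriv ?_
    simp; ring
  have h2 := h.exp.div_const √(2 * Real.pi)
  rw [show gaussianPDFReal 0 1 = fun y ↦ Real.exp (-y ^ 2 / 2) / √(2 * Real.pi) from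
    funext gaussianPDFReal_zero_one]
  exact h2.congr_deriv (by ring)

lemma tendsto_id_mul_gaussianPDFReal :
    Filter.Tendsto (fun y ↦ y * gaussianPDFReal 0 1 y) Filter.atTop (nhds 0) := by
  have h := (rpow_mul_exp_neg_mul_sq_isLittleO_exp_neg (b := 1 / 2) (by norm_num) 1).trans_tendsto
    (Real.tendsto_exp_atBot.comp
      (Filter.tendsto_id.const_mul_atTop_of_neg (r := -(1 / 2 : ℝ)) (by norm_num)))
  have h2 := h.div_const √(2 * Real.pi)
  rw [zero_div] at h2
  refine h2.congr fun y ↦ ?_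
  rw [gaussianPDFReal_zero_one, Real.rpow_one]
  ring_nf

/-- The upper truncated second moment of the standard Gaussian law. -/
lemma setIntegral_Ioi_sq_mul_gaussianPDFReal (t : ℝ) :
    ∫ y in Set.Ioi t, y ^ 2 * gaussianPDFReal 0 1 y = t * gaussianPDFReal 0 1 t + gaussQ t := by
  have hi := integrable_sq_mul_gaussianPDFReal.integrableOn (s := Set.Ioi t)
  have hg := (integrable_gaussianPDFReal 0 1).integrableOn (s := Set.Ioi t)
  have h := integral_Ioi_of_hasDerivAt_of_tendsto' (a := t)
    (f := fun y ↦ y * gaussianPDFReal 0 1 y)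
    (f' := fun y ↦ gaussianPDFReal 0 1 y - y ^ 2 * gaussianPDFReal 0 1 y)
    (fun y _ ↦ ((hasDerivAt_id y).mul (hasDerivAt_gaussianPDFReal_zero_one y)).congr_deriv
      (by simp; ring)) (hg.sub hi) tendsto_id_mul_gaussianPDFReal
  rw [integral_sub hg hi] at h
  have hQ : gaussQ t = ∫ y in Set.Ioi t, gaussianPDFReal 0 1 y := by
    simp only [gaussQ, gaussianPDFReal_zero_one]
  linarith

/-- The two-sided truncated second moment of the standard Gaussian law is `2 r₀`. -/
lemma integral_sq_indicator_gaussianReal {h : ℝ} (hh : 0 < h) :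
    ∫ y, (if √(2 * h) < |y| then y ^ 2 else 0) ∂(gaussianReal 0 1) = 2 * r0Fun h := by
  rw [integral_gaussianReal_eq_integral_smul one_ne_zero]
  have habs := integral_comp_abs
    (f := (Set.Ioi √(2 * h)).indicator fun y ↦ y ^ 2 * gaussianPDFReal 0 1 y)
  rw [setIntegral_indicator measurableSet_Ioi, Set.Ioi_inter_Ioi,
    max_eq_right (Real.sqrt_nonneg _), setIntegral_Ioi_sq_mul_gaussianPDFReal] at habs
  have hφ : √(2 * h) * gaussianPDFReal 0 1 √(2 * h) = Real.exp (-h) * √(h / Real.pi) := by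
    rw [gaussianPDFReal_zero_one, Real.sq_sqrt (by positivity), Real.sqrt_mul (by norm_num) h,
      Real.sqrt_mul (by norm_num) Real.pi, Real.sqrt_div hh.le]
    field_simp
  rw [r0Fun, ← hφ, ← habs]
  congr 1 with y
  simp only [Set.indicator_apply, Set.mem_Ioi, gaussianPDFReal_zero_one, sq_abs, smul_eq_mul]
  split_ifs <;> ring

lemma mul_hardThresh_mul {mh s : ℝ} (hs : 0 < s) (u : ℝ) :
    u * hardThresh (s * u) mh = s / mh * if √(2 * (mh / s ^ 2)) < |u| then u ^ 2 else 0 := by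
  have hsq : √(2 * (mh / s ^ 2)) = √(2 * mh) / s := by
    rw [← mul_div_assoc, Real.sqrt_div' _ (by positivity), Real.sqrt_sq hs.le]
  have hiff : √(2 * mh) < |s * u| ↔ √(2 * (mh / s ^ 2)) < |u| := by
    rw [hsq, div_lt_iff₀ hs, abs_mul, abs_of_pos hs, mul_comm s]
  simp only [hardThresh, hiff]
  split_ifs <;> ring

lemma integral_mul_hardThresh {mh s : ℝ} (hm : 0 < mh) (hs : 0 < s) :
    ∫ u, u * hardThresh (s * u) mh ∂(gaussianReal 0 1) = 2 * s / mh * r0Fun (mh / s ^ 2) := by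
  simp only [mul_hardThresh_mul hs]
  rw [integral_const_mul, integral_sq_indicator_gaussianReal (by positivity)]
  ring

lemma integrable_snd_mul_hardThresh (mh a b : ℝ) :
    Integrable (fun p : ℝ × ℝ ↦ p.2 * hardThresh (a * p.2 + b * p.1) mh)
      ((gaussianReal 0 1).prod (gaussianReal 0 1)) := by
  have hzz := (integrable_sq_gaussianReal.comp_snd (gaussianReal 0 1)).const_mul (a / mh)
  have hxz := (integrable_id_gaussianReal.mul_prod integrable_id_gaussianReal).const_mul (b / mh)
  have hmeas := (measurable_hardThresh mh).comp
    (by fun_prop : Measurable fun p : ℝ × ℝ ↦ a * p.2 + b * p.1)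
  refine (hzz.add hxz).mono (measurable_snd.mul hmeas).aestronglyMeasurable
    (ae_of_all _ fun p ↦ ?_)
  rw [norm_mul]
  refine (mul_le_mul_of_nonneg_left (norm_hardThresh_le _ _) (norm_nonneg _)).trans_eq ?_
  rw [← norm_mul]
  congr 1
  simp only [Pi.add_apply]
  ring

lemma integrable_mul_hardThresh (mh s : ℝ) :
    Integrable (fun u ↦ u * hardThresh (s * u) mh) (gaussianReal 0 1) := by
  refine (integrable_sq_gaussianReal.const_mul (s / mh)).mono
    (measurable_id.mul
      ((measurable_hardThresh mh).comp (measurable_const_mul s))).aestronglyMeasurable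
    (ae_of_all _ fun u ↦ ?_)
  rw [norm_mul]
  refine (mul_le_mul_of_nonneg_left (norm_hardThresh_le _ _) (norm_nonneg _)).trans_eq ?_
  rw [← norm_mul]
  congr 1
  ring

lemma integrable_hardThresh (mh s : ℝ) :
    Integrable (fun u ↦ hardThresh (s * u) mh) (gaussianReal 0 1) :=
  (integrable_id_gaussianReal.const_mul (s / mh)).mono
    ((measurable_hardThresh mh).comp (measurable_const_mul s)).aestronglyMeasurable
    (ae_of_all _ fun u ↦ (norm_hardThresh_le _ _).trans_eq (by congr 1; ring))

lemma integral_snd_mul_hardThresh {mh a b : ℝ} (hm : 0 < mh) (ha : 0 < a) :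
    ∫ p : ℝ × ℝ, p.2 * hardThresh (a * p.2 + b * p.1) mh
      ∂((gaussianReal 0 1).prod (gaussianReal 0 1)) =
      2 * a / mh * r0Fun (mh / (b ^ 2 + a ^ 2)) := by
  obtain ⟨s, θ, hs, hb, ha'⟩ : ∃ s θ : ℝ, 0 < s ∧ b = s * Real.cos θ ∧ a = s * Real.sin θ := by
    have hz : (⟨b, a⟩ : ℂ) ≠ 0 := fun h ↦ ha.ne' (congrArg Complex.im h)
    exact ⟨‖(⟨b, a⟩ : ℂ)‖, Complex.arg ⟨b, a⟩, norm_pos_iff.2 hz,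
      (Complex.norm_mul_cos_arg ⟨b, a⟩).symm, (Complex.norm_mul_sin_arg ⟨b, a⟩).symm⟩
  have hsq : b ^ 2 + a ^ 2 = s ^ 2 := by
    rw [hb, ha']; linear_combination s ^ 2 * Real.cos_sq_add_sin_sq θ
  have hrot := IsGaussian.map_rotation_eq_self (μ := gaussianReal 0 1) (by simp) θ
  have hpt : ∀ p : ℝ × ℝ, p.2 * hardThresh (a * p.2 + b * p.1) mh =
      (fun q : ℝ × ℝ ↦ Real.sin θ * (q.1 * hardThresh (s * q.1) mh) +
        Real.cos θ * (hardThresh (s * q.1) mh * q.2)) (ContinuousLinearMap.rotation θ p) := by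
    intro p
    simp only [ContinuousLinearMap.rotation_apply, smul_eq_mul]
    rw [show a * p.2 + b * p.1 = s * (Real.cos θ * p.1 + Real.sin θ * p.2) by
      rw [hb, ha']; ring]
    linear_combination (-p.2 * hardThresh (s * (Real.cos θ * p.1 + Real.sin θ * p.2)) mh) *
      Real.cos_sq_add_sin_sq θ
  have hfst := (integrable_mul_hardThresh mh s).comp_fst (gaussianReal 0 1)
  have hprod := (integrable_hardThresh mh s).mul_prod integrable_id_gaussianReal
  have hint := (hfst.const_mul (Real.sin θ)).add (hprod.const_mul (Real.cos θ))
  have hmap := integral_map (μ := (gaussianReal 0 1).prod (gaussianReal 0 1))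
    (ContinuousLinearMap.rotation θ).continuous.aemeasurable
    (hrot.symm ▸ hint.aestronglyMeasurable)
  rw [integral_congr_ae (ae_of_all _ hpt)]
  refine hmap.symm.trans ?_
  rw [hrot,
    integral_add' (hfst.const_mul _) (hprod.const_mul _), integral_const_mul, integral_const_mul,
    integral_prod_mul (fun u ↦ hardThresh (s * u) mh) (fun u ↦ u),
    integral_fun_fst (fun u ↦ u * hardThresh (s * u) mh),
    integral_mul_hardThresh hm hs, integral_id_gaussianReal, hsq]
  simp only [probReal_univ, one_smul]
  rw [ha']
  ring

/-- `(1/√χ̂)·E[z·x̂₀(√χ̂·z + m̂·x⁰; m̂)]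
= (2(1−ρ)/m̂)·r₀(m̂/χ̂) + (2ρ/m̂)·r₀(m̂/(m̂²+χ̂))` for `x⁰ ~ μ_ρ` and an independent
standard Gaussian `z`. -/
theorem stmt_12 (ρ mh χh : ℝ) (hρ : ρ ∈ Set.Icc (0 : ℝ) 1) (hm : 0 < mh) (hχ : 0 < χh) :
    (1 / Real.sqrt χh) *
        ∫ p : ℝ × ℝ, p.2 * hardThresh (Real.sqrt χh * p.2 + mh * p.1) mh
          ∂((bgMeasure ρ).prod (gaussianReal 0 1)) =
      (2 * (1 - ρ) / mh) * r0Fun (mh / χh) + (2 * ρ / mh) * r0Fun (mh / (mh ^ 2 + χh)) := by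
  obtain ⟨hρ0, hρ1⟩ := hρ
  have hs := Real.sqrt_pos.2 hχ
  set f : ℝ × ℝ → ℝ := fun p ↦ p.2 * hardThresh (√χh * p.2 + mh * p.1) mh with hf
  have hdirac : (Measure.dirac (0 : ℝ)).prod (gaussianReal 0 1) =
      (gaussianReal 0 1).map (Prod.mk 0) := Measure.dirac_prod 0
  have hfm : Measurable f := measurable_snd.mul ((measurable_hardThresh mh).comp (by fun_prop))
  have hf0 : f ∘ Prod.mk 0 = fun u ↦ u * hardThresh (√χh * u) mh := by
    ext u; simp [hf]
  have hi0 : Integrable f ((Measure.dirac 0).prod (gaussianReal 0 1)) := by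
    rw [hdirac, integrable_map_measure hfm.aestronglyMeasurable (by fun_prop), hf0]
    exact integrable_mul_hardThresh mh _
  have hI0 : ∫ p, f p ∂((Measure.dirac 0).prod (gaussianReal 0 1)) =
      2 * √χh / mh * r0Fun (mh / χh) := by
    rw [hdirac, integral_map (by fun_prop) hfm.aestronglyMeasurable]
    have := integral_mul_hardThresh hm hs
    rw [Real.sq_sqrt hχ.le, ← hf0] at this
    exact this
  have hI1 := integral_snd_mul_hardThresh (b := mh) hm hs
  rw [Real.sq_sqrt hχ.le] at hI1
  rw [bgMeasure, Measure.add_prod, Measure.prod_smul_left, Measure.prod_smul_left,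
    integral_add_measure (hi0.smul_measure ENNReal.ofReal_ne_top)
      ((integrable_snd_mul_hardThresh mh _ _).smul_measure ENNReal.ofReal_ne_top),
    integral_smul_measure, integral_smul_measure, hI0, hI1,
    ENNReal.toReal_ofReal (by linarith), ENNReal.toReal_ofReal hρ0]
  simp only [smul_eq_mul]
  field_simp
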